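/- For every ε > 0 there exists a constant C = C(ε) such that the following holds for every λ > 1. Let u₁, u₂ ∈ ℝ³ be nonzero vectors with |u₁ × u₂| ≥ (1/2)|u₁||u₂| (i.e., the corresponding unit bands are ν-transverse with ν = ν_{2,3} = 1/2), and let x₀₁, x₀₂ ∈ ℝ³. Then the number of lattice points in the intersection of the two unit bands, i.e. the cardinality of {n ∈ ℤ³ : |n| = λ, |u₁·(n−x₀₁)| ≤ |u₁|, |u₂·(n−x₀₂)| ≤ |u₂|}, is at most C·λ^{1/6+ε}. In other words, A_{2,3,λ} ≲ λ^{1/6+ε}. -/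

import Mathlib

theorem div_bound (ε : ℝ) (hε : 0 < ε) :
    ∃ C : ℝ, 1 ≤ C ∧ ∀ n : ℕ, n ≠ 0 → (n.divisors.card : ℝ) ≤ C * (n : ℝ) ^ ε := by
  set δ : ℝ := ε * Real.log 2 with hδ
  have hlog : 0 < Real.log 2 := Real.log_pos (by norm_num)
  have hδ0 : 0 < δ := by positivity
  set K : ℝ := 1 + 1 / δ with hK
  have hK1 : 1 ≤ K := by rw [hK]; have : 0 < 1 / δ := by positivity
                         linarith
  obtain ⟨B, hB⟩ := exists_nat_ge ((2 : ℝ) ^ (1 / ε))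
  refine ⟨K ^ B, one_le_pow₀ hK1, fun n hn => ?_⟩
  have key : ∀ p ∈ n.primeFactors, ((n.factorization p + 1 : ℕ) : ℝ) ≤
      (if p < B then K else 1) * ((p : ℝ) ^ n.factorization p) ^ ε := by
    intro p hp
    have hpp := Nat.prime_of_mem_primeFactors hp
    have hp2 : (2 : ℝ) ≤ p := by exact_mod_cast hpp.two_le
    set k := n.factorization p
    have e1 : ((p : ℝ) ^ k) ^ ε = ((p : ℝ) ^ ε) ^ k := by
      rw [← Real.rpow_natCast, ← Real.rpow_natCast, ← Real.rpow_mul (by linarith),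
        ← Real.rpow_mul (by linarith), mul_comm]
    rw [e1]
    split_ifs with h
    · have h1 : (1 + δ) ≤ (p : ℝ) ^ ε := by
        calc 1 + δ ≤ Real.exp δ := by linarith [Real.add_one_le_exp δ]
          _ = (2 : ℝ) ^ ε := by rw [Real.rpow_def_of_pos (by norm_num), hδ, mul_comm]
          _ ≤ _ := Real.rpow_le_rpow (by norm_num) hp2 hε.le
      have h2 : 1 + (k : ℝ) * δ ≤ ((p : ℝ) ^ ε) ^ k :=
        (one_add_mul_le_pow (by linarith) k).trans (pow_le_pow_left₀ (by linarith) h1 k)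
      have h3 : ((k + 1 : ℕ) : ℝ) ≤ K * (1 + k * δ) := by
        have : K * (1 + k * δ) = 1 + k + k * δ + 1 / δ := by
          rw [hK]; field_simp; ring
        rw [this]; push_cast
        have : 0 < 1 / δ := by positivity
        have : 0 ≤ k * δ := by positivity
        linarith
      exact h3.trans (mul_le_mul_of_nonneg_left h2 (by linarith))
    · have hpB : (2 : ℝ) ^ (1 / ε) ≤ p := hB.trans (by exact_mod_cast not_lt.mp h)
      have h1 : (2 : ℝ) ≤ (p : ℝ) ^ ε := by
        calc (2 : ℝ) = ((2 : ℝ) ^ (1 / ε)) ^ ε := by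
              rw [← Real.rpow_mul (by norm_num)]; field_simp; simp
          _ ≤ _ := Real.rpow_le_rpow (by positivity) hpB hε.le
      rw [one_mul]
      calc ((k + 1 : ℕ) : ℝ) ≤ (2 : ℝ) ^ k := by exact_mod_cast Nat.lt_two_pow_self
        _ ≤ _ := pow_le_pow_left₀ (by norm_num) h1 k
  rw [Nat.card_divisors hn]
  have e2 : (n : ℝ) ^ ε = ∏ p ∈ n.primeFactors, ((p : ℝ) ^ n.factorization p) ^ ε := by
    rw [Real.finsetProd_rpow _ _ (fun i _ => by positivity)]
    congr 1
    conv_lhs => rw [← Nat.prod_factorization_pow_eq_self hn]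
    rw [Finsupp.prod, Nat.support_factorization]
    push_cast; rfl
  rw [e2, Nat.cast_prod]
  refine (Finset.prod_le_prod (fun i _ => by positivity) key).trans ?_
  rw [Finset.prod_mul_distrib]
  refine mul_le_mul_of_nonneg_right ?_ (Finset.prod_nonneg fun i _ => by positivity)
  rw [← Finset.prod_filter, Finset.prod_const]
  refine pow_le_pow_right₀ hK1 ?_
  calc _ ≤ (Finset.range B).card := Finset.card_le_card (by intro p; simp)
    _ = B := by simp

theorem fiber_bound (D M : ℤ) (hD : 0 < D) (hM : 0 < M) (X' Y' : ℤ)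
    (h' : X' ^ 2 + D * Y' ^ 2 = M) (T : Finset (ℤ × ℤ))
    (hT : ∀ z ∈ T, z.1 ^ 2 + D * z.2 ^ 2 = M ∧ M ∣ 2 * (z.1 * Y' - X' * z.2)) :
    T.card ≤ 10 := by
  have : T.card ≤ ((Finset.Icc (-2 : ℤ) 2) ×ˢ (Finset.univ : Finset Bool)).card := by
    refine Finset.card_le_card_of_injOn
      (fun z => ((2 * (z.1 * Y' - X' * z.2)) / M, decide (0 ≤ z.1 * X' + D * z.2 * Y'))) ?_ ?_
    · rintro ⟨X, Y⟩ hz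
      obtain ⟨h1, q, hq⟩ := hT _ hz
      simp only at h1 hq
      simp only [Finset.coe_product, Set.mem_prod, Finset.mem_coe, Finset.mem_univ, and_true,
        Finset.mem_Icc]
      rw [hq, Int.mul_ediv_cancel_left _ hM.ne']
      have e : (X * X' + D * Y * Y') ^ 2 + D * (X * Y' - X' * Y) ^ 2 = M ^ 2 := by
        rw [show M ^ 2 = M * M by ring]
        nth_rewrite 1 [← h1]
        rw [← h']; ring
      have e4 : D * (M * q) ^ 2 ≤ 4 * M ^ 2 := by
        rw [← hq]; nlinarith [sq_nonneg (X * X' + D * Y * Y')]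
      have e5 : q ^ 2 ≤ 4 := by
        have : M ^ 2 * q ^ 2 ≤ M ^ 2 * 4 := by nlinarith [sq_nonneg (M * q)]
        exact le_of_mul_le_mul_left this (by positivity)
      constructor <;> nlinarith
    · rintro ⟨X, Y⟩ hz ⟨Z, W⟩ hw heq
      obtain ⟨h1, q, hq⟩ := hT _ hz
      obtain ⟨h2, r, hr⟩ := hT _ hw
      simp only at h1 hq h2 hr
      simp only [Prod.mk.injEq, decide_eq_decide] at heq
      obtain ⟨ha, hb⟩ := heq
      rw [hq, hr, Int.mul_ediv_cancel_left _ hM.ne', Int.mul_ediv_cancel_left _ hM.ne'] at ha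
      have ht : X * Y' - X' * Y = Z * Y' - X' * W := by
        subst ha; linarith
      have e : (X * X' + D * Y * Y') ^ 2 + D * (X * Y' - X' * Y) ^ 2 = M ^ 2 := by
        rw [show M ^ 2 = M * M by ring]
        nth_rewrite 1 [← h1]
        rw [← h']; ring
      have e' : (Z * X' + D * W * Y') ^ 2 + D * (Z * Y' - X' * W) ^ 2 = M ^ 2 := by
        rw [show M ^ 2 = M * M by ring]
        nth_rewrite 1 [← h2]
        rw [← h']; ring
      have hs2 : (X * X' + D * Y * Y') ^ 2 = (Z * X' + D * W * Y') ^ 2 := by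
        rw [ht] at e; linarith
      have hs : X * X' + D * Y * Y' = Z * X' + D * W * Y' := by
        rcases sq_eq_sq_iff_eq_or_eq_neg.mp hs2 with h | h
        · exact h
        · by_cases h0 : 0 ≤ X * X' + D * Y * Y'
          · have := hb.mp h0; linarith
          · have := mt hb.mpr h0; linarith
      have f1 : M * X = M * Z := by
        rw [← h']
        linear_combination X' * hs + D * Y' * ht
      have f2 : M * Y = M * W := by
        rw [← h']
        linear_combination Y' * hs - X' * ht
      exact Prod.ext (mul_left_cancel₀ hM.ne' f1) (mul_left_cancel₀ hM.ne' f2)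
  simpa using this

theorem gcd_two (D X Y g : ℤ) (hD : Squarefree D) (hXY : IsCoprime X Y)
    (hg : g ^ 2 ∣ X ^ 2 + D * Y ^ 2) (h2 : g ∣ 2 * X) : g ∣ 2 := by
  have main : ∀ k : ℤ, k ∣ g → k ∣ X → IsUnit k := by
    intro k hkg hkX
    have h1 : k ^ 2 ∣ D * Y ^ 2 := by
      have := (pow_dvd_pow_of_dvd hkg 2).trans hg
      exact (dvd_add_right (pow_dvd_pow_of_dvd hkX 2)).mp this
    have h3 : IsCoprime (k ^ 2) (Y ^ 2) := (hXY.of_isCoprime_of_dvd_left hkX).pow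
    have h4 := h3.dvd_of_dvd_mul_right h1
    exact hD k (by rwa [← sq])
  rcases Int.even_or_odd' g with ⟨k, hk | hk⟩
  · have hkX : k ∣ X := by
      rw [hk] at h2
      exact (mul_dvd_mul_iff_left (by norm_num)).mp h2
    have hu := main k ⟨2, by rw [hk]; ring⟩ hkX
    rw [hk]
    obtain ⟨c, hc⟩ := hu.dvd (a := (1 : ℤ))
    exact ⟨c, by rw [mul_assoc, ← hc]; norm_num⟩
  · have hc : IsCoprime g 2 := ⟨1, -k, by rw [hk]; ring⟩
    exact (main g dvd_rfl (hc.dvd_of_dvd_mul_left h2)).dvd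

theorem prim_bound (D : ℤ) (M : ℕ) (hD : 0 < D) (hsq : Squarefree D) (hM : 0 < M)
    (S : Finset (ℤ × ℤ))
    (hS : ∀ z ∈ S, z.1 ^ 2 + D * z.2 ^ 2 = M ∧ IsCoprime z.1 z.2) :
    S.card ≤ 10 * M.divisors.card := by
  classical
  rcases S.eq_empty_or_nonempty with rfl | ⟨⟨X0, Y0⟩, h0⟩
  · simp
  obtain ⟨hn0, hc0⟩ := hS _ h0
  simp only at hn0 hc0
  have hMZ : (0 : ℤ) < M := by exact_mod_cast hM
  have hcY : IsCoprime (M : ℤ) Y0 := by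
    rw [← hn0]
    have : IsCoprime (X0 ^ 2 + Y0 * (D * Y0)) Y0 := (hc0.pow_left (m := 2)).add_mul_left_left _
    convert this using 1; ring
  refine Finset.card_le_mul_card_image_of_maps_to
    (f := fun z : ℤ × ℤ => Int.gcd (z.1 * Y0 - X0 * z.2) M) ?_ 10 ?_
  · intro z _
    simp only [Nat.mem_divisors]
    exact ⟨by exact_mod_cast Int.gcd_dvd_right (z.1 * Y0 - X0 * z.2) (M : ℤ), hM.ne'⟩
  · intro e he
    rcases (S.filter (fun z : ℤ × ℤ => Int.gcd (z.1 * Y0 - X0 * z.2) M = e)).eq_empty_or_nonempty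
      with h | ⟨⟨X', Y'⟩, h1⟩
    · rw [h]; simp
    have hed : (e : ℤ) ∣ M := by exact_mod_cast (Nat.mem_divisors.mp he).1
    obtain ⟨h, hh⟩ := hed
    have he0 : (e : ℤ) ≠ 0 := by rintro h3; rw [h3] at hh; simp at hh; omega
    have prop : ∀ X Y : ℤ, X ^ 2 + D * Y ^ 2 = M → Int.gcd (X * Y0 - X0 * Y) M = e →
        (e : ℤ) ∣ X * Y0 - X0 * Y ∧ h ∣ X * Y0 + X0 * Y := by
      intro X Y hXY hgcd
      have hd : (e : ℤ) ∣ X * Y0 - X0 * Y := by rw [← hgcd]; exact Int.gcd_dvd_left _ _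
      refine ⟨hd, ?_⟩
      obtain ⟨r, hr⟩ := hd
      have hcop : IsCoprime r h := by
        have hb : ((Int.gcd (X * Y0 - X0 * Y) M : ℕ) : ℤ) = _ :=
          Int.gcd_eq_gcd_ab (X * Y0 - X0 * Y) M
        rw [hgcd] at hb
        refine ⟨Int.gcdA (X * Y0 - X0 * Y) M, Int.gcdB (X * Y0 - X0 * Y) M, ?_⟩
        apply mul_left_cancel₀ he0
        generalize Int.gcdA (X * Y0 - X0 * Y) M = A at *
        generalize Int.gcdB (X * Y0 - X0 * Y) M = B at *
        rw [hr] at hb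
        rw [mul_one]
        conv_rhs => rw [hb, hh]
        ring
      have hMd : (M : ℤ) ∣ (X * Y0 - X0 * Y) * (X * Y0 + X0 * Y) :=
        ⟨Y0 ^ 2 - Y ^ 2, by linear_combination Y0 ^ 2 * hXY - Y ^ 2 * hn0⟩
      rw [hr, hh, mul_assoc] at hMd
      have := (mul_dvd_mul_iff_left he0).mp hMd
      exact hcop.symm.dvd_of_dvd_mul_left this
    rw [Finset.mem_filter] at h1
    obtain ⟨h1S, h1g⟩ := h1
    obtain ⟨hn1, hc1⟩ := hS _ h1S
    simp only at hn1 hc1 h1g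
    obtain ⟨p1, p2⟩ := prop X' Y' hn1 h1g
    refine fiber_bound D M hD hMZ X' Y' hn1 _ ?_
    rintro ⟨X, Y⟩ hz
    rw [Finset.mem_filter] at hz
    obtain ⟨hzS, hzg⟩ := hz
    obtain ⟨hn, hc⟩ := hS _ hzS
    simp only at hn hc hzg
    refine ⟨hn, ?_⟩
    simp only
    obtain ⟨q1, q2⟩ := prop X Y hn hzg
    have hecY : IsCoprime (e : ℤ) Y0 := hcY.of_isCoprime_of_dvd_left ⟨h, hh⟩
    have hhcY : IsCoprime h Y0 := hcY.of_isCoprime_of_dvd_left ⟨e, by rw [hh]; ring⟩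
    have d1 : (e : ℤ) ∣ X * Y' - X' * Y := by
      apply hecY.dvd_of_dvd_mul_left
      have := dvd_sub (q1.mul_left Y') (p1.mul_left Y)
      convert this using 1; ring
    have d2 : h ∣ X * Y' - X' * Y := by
      apply hhcY.dvd_of_dvd_mul_left
      have := dvd_sub (q2.mul_left Y') (p2.mul_left Y)
      convert this using 1; ring
    have hg2 : ((Int.gcd e h : ℕ) : ℤ) ∣ 2 := by
      have ge : ((Int.gcd e h : ℕ) : ℤ) ∣ e := Int.gcd_dvd_left _ _
      have gh : ((Int.gcd e h : ℕ) : ℤ) ∣ h := Int.gcd_dvd_right _ _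
      apply gcd_two D X Y _ hsq hc
      · rw [hn, hh, sq]; exact mul_dvd_mul ge gh
      · have h3 := dvd_add (ge.trans q1) (gh.trans q2)
        apply (hecY.of_isCoprime_of_dvd_left ge).dvd_of_dvd_mul_left
        convert h3 using 1; ring
    rw [hh]
    have hl : (Int.lcm e h : ℤ) ∣ X * Y' - X' * Y := Int.coe_lcm_dvd d1 d2
    have hm := mul_dvd_mul hg2 hl
    have h5 : (e : ℤ) * h ∣ ((Int.gcd e h : ℕ) : ℤ) * (Int.lcm e h : ℤ) := by
      have := Int.gcd_mul_lcm (e : ℤ) h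
      rw [← Nat.cast_mul, this]
      rw [← Int.natAbs_mul]
      exact Int.dvd_natAbs.mpr dvd_rfl
    exact h5.trans hm

theorem sqf_bound (D : ℤ) (M : ℕ) (hD : 0 < D) (hsq : Squarefree D) (hM : 0 < M)
    (S : Finset (ℤ × ℤ))
    (hS : ∀ z ∈ S, z.1 ^ 2 + D * z.2 ^ 2 = M) :
    S.card ≤ 10 * M.divisors.card ^ 2 := by
  classical
  rw [sq, ← mul_assoc]
  refine Finset.card_le_mul_card_image_of_maps_to
    (f := fun z : ℤ × ℤ => Int.gcd z.1 z.2) ?_ _ ?_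
  · intro z hz
    simp only [Nat.mem_divisors]
    refine ⟨?_, hM.ne'⟩
    have h1 : ((Int.gcd z.1 z.2 : ℕ) : ℤ) ∣ M := by
      rw [← hS z hz]
      exact dvd_add ((Int.gcd_dvd_left _ _).trans (dvd_pow_self _ two_ne_zero))
        (((Int.gcd_dvd_right _ _).trans (dvd_pow_self _ two_ne_zero)).mul_left _)
    exact_mod_cast h1
  · intro g hg
    have hg0 : g ≠ 0 := by
      rintro rfl; simp at hg
    have hgZ : (g : ℤ) ≠ 0 := by exact_mod_cast hg0
    rcases (S.filter (fun z : ℤ × ℤ => Int.gcd z.1 z.2 = g)).eq_empty_or_nonempty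
      with h | ⟨z0, h1⟩
    · rw [h]; simp
    have dv : ∀ z ∈ S.filter (fun z : ℤ × ℤ => Int.gcd z.1 z.2 = g),
        ∃ a b : ℤ, z = (g * a, g * b) ∧ IsCoprime a b := by
      intro z hz
      rw [Finset.mem_filter] at hz
      have d1 : (g : ℤ) ∣ z.1 := hz.2 ▸ Int.gcd_dvd_left _ _
      have d2 : (g : ℤ) ∣ z.2 := hz.2 ▸ Int.gcd_dvd_right _ _
      obtain ⟨a, ha⟩ := d1
      obtain ⟨b, hb⟩ := d2
      refine ⟨a, b, Prod.ext ha hb, ?_⟩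
      have h3 := hz.2
      rw [ha, hb, Int.gcd_mul_left] at h3
      rw [Int.isCoprime_iff_gcd_eq_one]
      simp only [Int.natAbs_natCast] at h3
      exact Nat.eq_of_mul_eq_mul_left (Nat.pos_of_ne_zero hg0) (by rw [h3, mul_one])
    have hdiv : g ^ 2 ∣ M := by
      obtain ⟨a, b, hz, _⟩ := dv z0 h1
      have := hS z0 (Finset.mem_filter.mp h1).1
      rw [hz] at this
      have h4 : ((g : ℤ)) ^ 2 ∣ M := ⟨a ^ 2 + D * b ^ 2, by rw [← this]; ring⟩
      exact_mod_cast h4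
    obtain ⟨M', hM'⟩ := hdiv
    have hM'0 : 0 < M' := by
      rcases Nat.eq_zero_or_pos M' with h | h
      · rw [h] at hM'; omega
      · exact h
    set T := (S.filter (fun z : ℤ × ℤ => Int.gcd z.1 z.2 = g)).image
      (fun z => (z.1 / (g : ℤ), z.2 / (g : ℤ))) with hT
    have hcard : (S.filter (fun z : ℤ × ℤ => Int.gcd z.1 z.2 = g)).card = T.card := by
      rw [hT, Finset.card_image_of_injOn]
      intro z hz w hw h
      obtain ⟨a, b, rfl, _⟩ := dv z hz
      obtain ⟨c, d, rfl, _⟩ := dv w hw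
      simp only [Int.mul_ediv_cancel_left _ hgZ, Prod.mk.injEq] at h
      rw [h.1, h.2]
    rw [hcard]
    refine (prim_bound D M' hD hsq hM'0 T ?_).trans ?_
    · intro t ht
      rw [hT, Finset.mem_image] at ht
      obtain ⟨z, hz, rfl⟩ := ht
      have hzS := hS z (Finset.mem_filter.mp hz).1
      obtain ⟨a, b, rfl, hab⟩ := dv z hz
      simp only [Int.mul_ediv_cancel_left _ hgZ]
      refine ⟨?_, hab⟩
      apply mul_left_cancel₀ (pow_ne_zero 2 hgZ)
      rw [hM'] at hzS
      push_cast at hzS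
      rw [← hzS]; ring
    · refine Nat.mul_le_mul_left _ (Finset.card_le_card (Nat.divisors_subset_of_dvd hM.ne' ?_))
      exact ⟨g ^ 2, by rw [hM']; ring⟩

theorem form_bound (D : ℤ) (M : ℤ) (hD : 0 < D) (B : ℝ) (T : ℝ) (hT : 1 ≤ T)
    (hB : ∀ n : ℕ, n ≠ 0 → (n : ℝ) ≤ B → (n.divisors.card : ℝ) ≤ T) (hMB : (M : ℝ) ≤ B)
    (S : Finset (ℤ × ℤ))
    (hS : ∀ z ∈ S, z.1 ^ 2 + D * z.2 ^ 2 = M) :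
    (S.card : ℝ) ≤ 10 * T ^ 2 := by
  classical
  rcases lt_trichotomy M 0 with h | h | h
  · have : S = ∅ := by
      apply Finset.eq_empty_of_forall_notMem
      intro z hz
      have := hS z hz
      nlinarith [sq_nonneg z.1, mul_nonneg hD.le (sq_nonneg z.2)]
    rw [this]; simp; positivity
  · have : S ⊆ {(0, 0)} := by
      intro z hz
      have h1 := hS z hz
      have h2 := mul_nonneg hD.le (sq_nonneg z.2)
      have h3 : z.1 ^ 2 = 0 := by nlinarith [sq_nonneg z.1]
      have h4 : D * z.2 ^ 2 = 0 := by nlinarith [sq_nonneg z.1]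
      have h5 : z.2 ^ 2 = 0 := (mul_eq_zero.mp h4).resolve_left hD.ne'
      rw [Finset.mem_singleton]
      exact Prod.ext (pow_eq_zero_iff (two_ne_zero) |>.mp h3) (pow_eq_zero_iff (two_ne_zero) |>.mp h5)
    have := Finset.card_le_card this
    simp at this
    have h1 : (S.card : ℝ) ≤ 1 := by exact_mod_cast this
    nlinarith
  · lift M to ℕ using h.le
    lift D to ℕ using hD.le
    obtain ⟨a, b, hab, hsq⟩ := Nat.sq_mul_squarefree D
    have hb : b ≠ 0 := by rintro rfl; simp at hab; omega
    have ha : a ≠ 0 := by rintro rfl; simp at hab; omega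
    have hMpos : 0 < M := by exact_mod_cast h
    have hinj : Function.Injective (fun z : ℤ × ℤ => (z.1, (b : ℤ) * z.2)) := by
      rintro ⟨x, y⟩ ⟨z, w⟩ h
      simp only [Prod.mk.injEq] at h
      have hb' : (b : ℤ) ≠ 0 := by exact_mod_cast hb
      exact Prod.ext h.1 (mul_left_cancel₀ hb' h.2)
    have h1 := sqf_bound a M (by exact_mod_cast Nat.pos_of_ne_zero ha)
      (Int.squarefree_natCast.mpr hsq) hMpos (S.image (fun z : ℤ × ℤ => (z.1, (b : ℤ) * z.2))) (by
        intro t ht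
        rw [Finset.mem_image] at ht
        obtain ⟨z, hz, rfl⟩ := ht
        rw [← hS z hz, ← hab]
        push_cast; ring)
    rw [Finset.card_image_of_injective _ hinj] at h1
    have h2 : (M.divisors.card : ℝ) ≤ T := hB M hMpos.ne' (by exact_mod_cast hMB)
    calc (S.card : ℝ) ≤ 10 * (M.divisors.card : ℝ) ^ 2 := by exact_mod_cast h1
      _ ≤ _ := by gcongr

theorem plane_bound (a1 a2 a3 m N Q : ℤ) (hne : ¬ (a1 = 0 ∧ a2 = 0 ∧ a3 = 0))
    (h1 : |a1| ≤ Q) (h2 : |a2| ≤ Q) (h3 : |a3| ≤ Q) (B : ℝ) (T : ℝ) (hT : 1 ≤ T)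
    (hB : ∀ n : ℕ, n ≠ 0 → (n : ℝ) ≤ B → (n.divisors.card : ℝ) ≤ T)
    (hN : 0 ≤ N) (hMB : ((6 * Q ^ 4 * N : ℤ) : ℝ) ≤ B)
    (S : Finset (Fin 3 → ℤ))
    (hS : ∀ n ∈ S, n 0 ^ 2 + n 1 ^ 2 + n 2 ^ 2 = N ∧ a1 * n 0 + a2 * n 1 + a3 * n 2 = m) :
    (S.card : ℝ) ≤ 10 * T ^ 2 := by
  classical
  have hQ0 : 0 ≤ Q := (abs_nonneg _).trans h1
  have s1 : a1 ^ 2 ≤ Q ^ 2 := sq_le_sq' (by linarith [neg_abs_le a1]) (by linarith [le_abs_self a1])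
  have s2 : a2 ^ 2 ≤ Q ^ 2 := sq_le_sq' (by linarith [neg_abs_le a2]) (by linarith [le_abs_self a2])
  have s3 : a3 ^ 2 ≤ Q ^ 2 := sq_le_sq' (by linarith [neg_abs_le a3]) (by linarith [le_abs_self a3])
  by_cases hF : a2 = 0 ∧ a3 = 0
  · obtain ⟨rfl, rfl⟩ := hF
    have ha1 : a1 ≠ 0 := fun h => hne ⟨h, rfl, rfl⟩
    rcases S.eq_empty_or_nonempty with rfl | ⟨n0, hn0⟩
    · simp; positivity
    have hc : ∀ n ∈ S, n 0 = n0 0 := by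
      intro n hn
      have e1 := (hS n hn).2
      have e2 := (hS n0 hn0).2
      exact mul_left_cancel₀ ha1 (by linarith)
    have hinj : Set.InjOn (fun n : Fin 3 → ℤ => (n 1, n 2)) S := by
      intro n hn k hk h
      simp only [Prod.mk.injEq] at h
      funext i
      fin_cases i
      · exact (hc n hn).trans (hc k hk).symm
      · exact h.1
      · exact h.2
    rw [← Finset.card_image_of_injOn hinj]
    refine form_bound 1 (N - n0 0 ^ 2) one_pos B T hT hB ?_ _ ?_
    · refine le_trans ?_ hMB
      have hQ1 : 1 ≤ Q := (Int.one_le_abs ha1).trans h1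
      have : 1 ≤ Q ^ 4 := one_le_pow₀ hQ1
      have : N - n0 0 ^ 2 ≤ 6 * Q ^ 4 * N := by nlinarith [sq_nonneg (n0 0)]
      exact_mod_cast this
    · intro z hz
      rw [Finset.mem_image] at hz
      obtain ⟨n, hn, rfl⟩ := hz
      have := (hS n hn).1
      rw [hc n hn] at this
      simp only
      linarith
  · have hFpos : 0 < a2 ^ 2 + a3 ^ 2 := by
      rcases not_and_or.mp hF with h | h
      · have := pow_pos (abs_pos.mpr h) 2; rw [sq_abs] at this; nlinarith [sq_nonneg a3]
      · have := pow_pos (abs_pos.mpr h) 2; rw [sq_abs] at this; nlinarith [sq_nonneg a2]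
    have hSpos : 0 < a1 ^ 2 + a2 ^ 2 + a3 ^ 2 := by nlinarith [sq_nonneg a1]
    have hinj : Set.InjOn (fun n : Fin 3 → ℤ =>
        (-(a2 ^ 2 + a3 ^ 2) * n 0 + a1 * (a2 * n 1 + a3 * n 2), a3 * n 1 - a2 * n 2)) S := by
      intro n hn k hk h
      simp only [Prod.mk.injEq] at h
      obtain ⟨hx, hy⟩ := h
      have hm : a1 * n 0 + a2 * n 1 + a3 * n 2 = a1 * k 0 + a2 * k 1 + a3 * k 2 :=
        (hS n hn).2.trans (hS k hk).2.symm
      have k0 : n 0 = k 0 := by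
        apply mul_left_cancel₀ hSpos.ne'
        linear_combination a1 * hm - hx
      have hp : a2 * n 1 + a3 * n 2 = a2 * k 1 + a3 * k 2 := by
        rw [k0] at hm; linarith
      have k1 : n 1 = k 1 := by
        apply mul_left_cancel₀ hFpos.ne'
        linear_combination a2 * hp + a3 * hy
      have k2 : n 2 = k 2 := by
        apply mul_left_cancel₀ hFpos.ne'
        linear_combination a3 * hp - a2 * hy
      funext i
      fin_cases i
      · exact k0
      · exact k1
      · exact k2
    rw [← Finset.card_image_of_injOn hinj]
    refine form_bound (a1 ^ 2 + a2 ^ 2 + a3 ^ 2)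
      ((a2 ^ 2 + a3 ^ 2) * (N * (a1 ^ 2 + a2 ^ 2 + a3 ^ 2) - m ^ 2)) hSpos B T hT hB ?_ _ ?_
    · refine le_trans ?_ hMB
      have : (a2 ^ 2 + a3 ^ 2) * (N * (a1 ^ 2 + a2 ^ 2 + a3 ^ 2) - m ^ 2) ≤ 6 * Q ^ 4 * N := by
        calc _ ≤ (a2 ^ 2 + a3 ^ 2) * (N * (3 * Q ^ 2)) := by
              apply mul_le_mul_of_nonneg_left _ hFpos.le
              nlinarith [sq_nonneg m]
          _ ≤ (2 * Q ^ 2) * (N * (3 * Q ^ 2)) := by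
              apply mul_le_mul_of_nonneg_right _ (by positivity)
              linarith
          _ = _ := by ring
      exact_mod_cast this
    · intro z hz
      rw [Finset.mem_image] at hz
      obtain ⟨n, hn, rfl⟩ := hz
      obtain ⟨e1, e2⟩ := hS n hn
      simp only
      rw [← e1, ← e2]
      ring

theorem dirichlet3 (w1 w2 w3 : ℝ) (h1 : |w1| ≤ 1) (h2 : |w2| ≤ 1) (h3 : |w3| ≤ 1)
    (Q : ℕ) (hQ : 0 < Q) :
    ∃ a1 a2 a3 : ℤ, ¬ (a1 = 0 ∧ a2 = 0 ∧ a3 = 0) ∧ |a1| ≤ Q ∧ |a2| ≤ Q ∧ |a3| ≤ Q ∧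
      |a1 * w1 + a2 * w2 + a3 * w3| ≤ 6 / (Q : ℝ) ^ 2 := by
  have hQR : (0 : ℝ) < Q := by exact_mod_cast hQ
  set box : Finset (ℤ × ℤ × ℤ) :=
    (Finset.Icc (0 : ℤ) Q) ×ˢ (Finset.Icc (0 : ℤ) Q) ×ˢ (Finset.Icc (0 : ℤ) Q) with hbox
  set f : ℤ × ℤ × ℤ → ℤ :=
    fun a => ⌊(a.1 * w1 + a.2.1 * w2 + a.2.2 * w3 + 3 * Q) * ((Q : ℝ) ^ 2 / 6)⌋ with hf
  have hcard : (Finset.Icc (0 : ℤ) ((Q : ℤ) ^ 3)).card < box.card := by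
    rw [hbox, Finset.card_product, Finset.card_product]
    simp only [Int.card_Icc, sub_zero]
    have e1 : ((Q : ℤ) + 1).toNat = Q + 1 := by omega
    have e2 : ((Q : ℤ) ^ 3 + 1).toNat = Q ^ 3 + 1 := by
      rw [← Nat.cast_pow]; omega
    rw [e1, e2]
    nlinarith [Nat.zero_le (Q ^ 2)]
  have bd : ∀ (x : ℤ) (w : ℝ), |w| ≤ 1 → 0 ≤ x → x ≤ Q → |x * w| ≤ Q := by
    intro x w hw hx hxQ
    rw [abs_mul]
    have e1 : |(x : ℝ)| ≤ Q := by
      rw [abs_of_nonneg (by exact_mod_cast hx)]; exact_mod_cast hxQ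
    calc _ ≤ (Q : ℝ) * 1 := mul_le_mul e1 hw (abs_nonneg _) hQR.le
      _ = _ := mul_one _
  have hmaps : Set.MapsTo f box (Finset.Icc (0 : ℤ) ((Q : ℤ) ^ 3)) := by
    rintro ⟨x, y, z⟩ hx
    simp only [hbox, Finset.mem_coe, Finset.mem_product, Finset.mem_Icc] at hx
    obtain ⟨⟨x0, xQ⟩, ⟨y0, yQ⟩, z0, zQ⟩ := hx
    have b1 := abs_le.mp (bd x w1 h1 x0 xQ)
    have b2 := abs_le.mp (bd y w2 h2 y0 yQ)
    have b3 := abs_le.mp (bd z w3 h3 z0 zQ)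
    simp only [hf, Finset.mem_coe, Finset.mem_Icc]
    have hpos : 0 < (Q : ℝ) ^ 2 / 6 := by positivity
    constructor
    · apply Int.floor_nonneg.mpr
      exact mul_nonneg (by linarith) hpos.le
    · have : (x * w1 + y * w2 + z * w3 + 3 * Q) * ((Q : ℝ) ^ 2 / 6) ≤ (((Q : ℤ) ^ 3 : ℤ) : ℝ) := by
        calc _ ≤ (6 * Q) * ((Q : ℝ) ^ 2 / 6) := by
              apply mul_le_mul_of_nonneg_right _ hpos.le
              linarith
          _ = _ := by push_cast; ring
      exact_mod_cast (Int.floor_le _).trans this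
  obtain ⟨a, ha, b, hb, hab, hfab⟩ := Finset.exists_ne_map_eq_of_card_lt_of_maps_to hcard hmaps
  obtain ⟨x, y, z⟩ := a
  obtain ⟨x', y', z'⟩ := b
  simp only [hbox, Finset.mem_product, Finset.mem_Icc] at ha hb
  refine ⟨x - x', y - y', z - z', ?_, ?_, ?_, ?_, ?_⟩
  · rintro ⟨e1, e2, e3⟩
    apply hab
    rw [sub_eq_zero.mp e1, sub_eq_zero.mp e2, sub_eq_zero.mp e3]
  · rw [abs_le]; omega
  · rw [abs_le]; omega
  · rw [abs_le]; omega
  · have := Int.abs_sub_lt_one_of_floor_eq_floor hfab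
    simp only at this
    rw [← sub_mul, abs_mul, abs_of_pos (show 0 < (Q : ℝ) ^ 2 / 6 by positivity)] at this
    push_cast
    rw [le_div_iff₀ (by positivity)]
    have e : (x * w1 + y * w2 + z * w3 + 3 * Q) - (x' * w1 + y' * w2 + z' * w3 + 3 * Q) =
      ((x : ℝ) - x') * w1 + (y - y') * w2 + (z - z') * w3 := by ring
    rw [e] at this
    linarith

theorem tube (u1 u2 u3 v1 v2 v3 U V : ℝ) (hU : 0 < U) (hV : 0 < V)
    (eU : u1 ^ 2 + u2 ^ 2 + u3 ^ 2 = U ^ 2) (eV : v1 ^ 2 + v2 ^ 2 + v3 ^ 2 = V ^ 2)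
    (ht : U ^ 2 * V ^ 2 / 4 ≤ U ^ 2 * V ^ 2 - (u1 * v1 + u2 * v2 + u3 * v3) ^ 2) :
    ∃ w1 w2 w3 : ℝ, w1 ^ 2 + w2 ^ 2 + w3 ^ 2 = 1 ∧ ∀ d1 d2 d3 : ℝ,
      |u1 * d1 + u2 * d2 + u3 * d3| ≤ 2 * U → |v1 * d1 + v2 * d2 + v3 * d3| ≤ 2 * V →
      d1 ^ 2 + d2 ^ 2 + d3 ^ 2 - (d1 * w1 + d2 * w2 + d3 * w3) ^ 2 ≤ 64 := by
  set c1 := u2 * v3 - u3 * v2 with hc1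
  set c2 := u3 * v1 - u1 * v3 with hc2
  set c3 := u1 * v2 - u2 * v1 with hc3
  set G := c1 ^ 2 + c2 ^ 2 + c3 ^ 2 with hG
  have hG1 : U ^ 2 * V ^ 2 / 4 ≤ G := by
    rw [← eU, ← eV] at ht ⊢
    rw [hG, hc1, hc2, hc3]
    nlinarith
  have hGpos : 0 < G := lt_of_lt_of_le (by positivity) hG1
  have hs := Real.sq_sqrt hGpos.le
  have hsp := Real.sqrt_pos.mpr hGpos
  refine ⟨c1 / √G, c2 / √G, c3 / √G, ?_, ?_⟩
  · rw [div_pow, div_pow, div_pow, hs, ← add_div, ← add_div, div_self hGpos.ne']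
  · intro d1 d2 d3 hp hq
    set p := u1 * d1 + u2 * d2 + u3 * d3 with hpdef
    set q := v1 * d1 + v2 * d2 + v3 * d3 with hqdef
    have hp2 : p ^ 2 ≤ 4 * U ^ 2 := by
      have := sq_le_sq' (abs_le.mp hp).1 (abs_le.mp hp).2; linarith
    have hq2 : q ^ 2 ≤ 4 * V ^ 2 := by
      have := sq_le_sq' (abs_le.mp hq).1 (abs_le.mp hq).2; linarith
    have e : (d1 * (c1 / √G) + d2 * (c2 / √G) + d3 * (c3 / √G)) ^ 2 =
        (d1 * c1 + d2 * c2 + d3 * c3) ^ 2 / G := by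
      rw [← hs, ← div_pow, hs]; congr 1; ring
    rw [e]
    have lag : (d1 ^ 2 + d2 ^ 2 + d3 ^ 2) * G - (d1 * c1 + d2 * c2 + d3 * c3) ^ 2 =
        (u1 * q - v1 * p) ^ 2 + (u2 * q - v2 * p) ^ 2 + (u3 * q - v3 * p) ^ 2 := by
      rw [hG, hc1, hc2, hc3, hpdef, hqdef]; ring
    have up : (u1 * q - v1 * p) ^ 2 + (u2 * q - v2 * p) ^ 2 + (u3 * q - v3 * p) ^ 2 ≤
        16 * U ^ 2 * V ^ 2 := by
      have i1 : (u1 * q - v1 * p) ^ 2 + (u2 * q - v2 * p) ^ 2 + (u3 * q - v3 * p) ^ 2 +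
          ((u1 * q + v1 * p) ^ 2 + (u2 * q + v2 * p) ^ 2 + (u3 * q + v3 * p) ^ 2) =
          2 * (U ^ 2 * q ^ 2 + V ^ 2 * p ^ 2) := by rw [← eU, ← eV]; ring
      have i2 : U ^ 2 * q ^ 2 ≤ U ^ 2 * (4 * V ^ 2) :=
        mul_le_mul_of_nonneg_left hq2 (sq_nonneg _)
      have i3 : V ^ 2 * p ^ 2 ≤ V ^ 2 * (4 * U ^ 2) :=
        mul_le_mul_of_nonneg_left hp2 (sq_nonneg _)
      have i4 := sq_nonneg (u1 * q + v1 * p)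
      have i5 := sq_nonneg (u2 * q + v2 * p)
      have i6 := sq_nonneg (u3 * q + v3 * p)
      linarith
    have : d1 ^ 2 + d2 ^ 2 + d3 ^ 2 - (d1 * c1 + d2 * c2 + d3 * c3) ^ 2 / G =
        ((d1 ^ 2 + d2 ^ 2 + d3 ^ 2) * G - (d1 * c1 + d2 * c2 + d3 * c3) ^ 2) / G := by
      field_simp
    rw [this, div_le_iff₀ hGpos, lag]
    linarith

theorem cs3 (y1 y2 y3 p1 p2 p3 : ℝ) : (y1 * p1 + y2 * p2 + y3 * p3) ^ 2 ≤
      (y1 ^ 2 + y2 ^ 2 + y3 ^ 2) * (p1 ^ 2 + p2 ^ 2 + p3 ^ 2) := by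
  linarith [sq_nonneg (y1 * p2 - y2 * p1), sq_nonneg (y1 * p3 - y3 * p1),
    sq_nonneg (y2 * p3 - y3 * p2)]

/-- Values of the linear form `a` on the points of the tube on the sphere. -/
theorem values (l w1 w2 w3 a1 a2 a3 x1 x2 x3 d1 d2 d3 Q η : ℝ) (hl : 1 < l) (hQ : 0 ≤ Q)
    (hw : w1 ^ 2 + w2 ^ 2 + w3 ^ 2 = 1)
    (h1 : a1 ^ 2 ≤ Q ^ 2) (h2 : a2 ^ 2 ≤ Q ^ 2) (h3 : a3 ^ 2 ≤ Q ^ 2)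
    (hη : |a1 * w1 + a2 * w2 + a3 * w3| ≤ η)
    (hx : x1 ^ 2 + x2 ^ 2 + x3 ^ 2 = l ^ 2)
    (hxd : (x1 + d1) ^ 2 + (x2 + d2) ^ 2 + (x3 + d3) ^ 2 = l ^ 2)
    (hd : d1 ^ 2 + d2 ^ 2 + d3 ^ 2 - (d1 * w1 + d2 * w2 + d3 * w3) ^ 2 ≤ 64) :
    |a1 * d1 + a2 * d2 + a3 * d3| ≤ 9 * √l * η + 16 * Q ∨
    |a1 * d1 + a2 * d2 + a3 * d3 + 2 * (x1 * w1 + x2 * w2 + x3 * w3) *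
      (a1 * w1 + a2 * w2 + a3 * w3)| ≤ 9 * √l * η + 16 * Q := by
  set t := d1 * w1 + d2 * w2 + d3 * w3 with ht
  set β := x1 * w1 + x2 * w2 + x3 * w3 with hβ
  set A := a1 * w1 + a2 * w2 + a3 * w3 with hA
  set p1 := d1 - t * w1 with hp1
  set p2 := d2 - t * w2 with hp2
  set p3 := d3 - t * w3 with hp3
  have hp : p1 ^ 2 + p2 ^ 2 + p3 ^ 2 = d1 ^ 2 + d2 ^ 2 + d3 ^ 2 - t ^ 2 := by
    have : p1 ^ 2 + p2 ^ 2 + p3 ^ 2 = d1 ^ 2 + d2 ^ 2 + d3 ^ 2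
        - 2 * t * (d1 * w1 + d2 * w2 + d3 * w3) + t ^ 2 * (w1 ^ 2 + w2 ^ 2 + w3 ^ 2) := by
      rw [hp1, hp2, hp3]; ring
    rw [this, hw, ← ht]; ring
  have cs : ∀ y1 y2 y3 : ℝ, (y1 * p1 + y2 * p2 + y3 * p3) ^ 2 ≤
      (y1 ^ 2 + y2 ^ 2 + y3 ^ 2) * 64 := by
    intro y1 y2 y3
    have : (y1 * p1 + y2 * p2 + y3 * p3) ^ 2 ≤
      (y1 ^ 2 + y2 ^ 2 + y3 ^ 2) * (p1 ^ 2 + p2 ^ 2 + p3 ^ 2) := cs3 _ _ _ _ _ _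
    refine this.trans (mul_le_mul_of_nonneg_left (by rw [hp]; exact hd) (by positivity))
  have hxp : |x1 * p1 + x2 * p2 + x3 * p3| ≤ 8 * l := by
    apply abs_le_of_sq_le_sq _ (by linarith)
    have := cs x1 x2 x3
    rw [hx] at this; linarith
  have hap : |a1 * p1 + a2 * p2 + a3 * p3| ≤ 16 * Q := by
    apply abs_le_of_sq_le_sq _ (by linarith)
    have := cs a1 a2 a3
    have h0 := sq_nonneg Q
    rw [show (16 * Q) ^ 2 = 256 * Q ^ 2 by ring]
    linarith
  have ead : a1 * d1 + a2 * d2 + a3 * d3 = t * A + (a1 * p1 + a2 * p2 + a3 * p3) := by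
    rw [hp1, hp2, hp3, hA]; ring
  have key : t * (t + 2 * β) = - (p1 ^ 2 + p2 ^ 2 + p3 ^ 2) - 2 * (x1 * p1 + x2 * p2 + x3 * p3) := by
    rw [hp]
    have : x1 * p1 + x2 * p2 + x3 * p3 = x1 * d1 + x2 * d2 + x3 * d3 - t * β := by
      rw [hp1, hp2, hp3, hβ]; ring
    rw [this]
    linarith
  have hkey : |t| * |t + 2 * β| ≤ 81 * l := by
    rw [← abs_mul, key, abs_le]
    obtain ⟨z1, z2⟩ := abs_le.mp hxp
    have : 0 ≤ p1 ^ 2 + p2 ^ 2 + p3 ^ 2 := by positivity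
    constructor <;> linarith
  have hsq : (9 * √l) * (9 * √l) = 81 * l := by
    have := Real.mul_self_sqrt (show 0 ≤ l by linarith); linarith
  have hor : |t| ≤ 9 * √l ∨ |t + 2 * β| ≤ 9 * √l := by
    by_contra! hcon
    have := mul_lt_mul'' hcon.1 hcon.2 (by positivity) (by positivity)
    linarith
  have fin : ∀ s : ℝ, |s| ≤ 9 * √l → |s * A + (a1 * p1 + a2 * p2 + a3 * p3)| ≤
      9 * √l * η + 16 * Q := by
    intro s hs
    refine (abs_add_le _ _).trans (add_le_add ?_ hap)
    rw [abs_mul]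
    exact mul_le_mul hs hη (abs_nonneg _) (by positivity)
  rcases hor with h | h
  · left; rw [ead]; exact fin t h
  · right
    have := fin _ h
    rw [ead]
    convert this using 2; ring

theorem int_count (c R : ℝ) (hR : 0 ≤ R) :
    ((Finset.Icc ⌈c - R⌉ ⌊c + R⌋).card : ℝ) ≤ 2 * R + 1 := by
  rw [Int.card_Icc]
  have h1 : (⌊c + R⌋ : ℝ) ≤ c + R := Int.floor_le _
  have h2 : c - R ≤ ⌈c - R⌉ := Int.le_ceil _
  have h3 : (((⌊c + R⌋ + 1 - ⌈c - R⌉).toNat : ℤ) : ℝ) ≤ 2 * R + 1 := by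
    rw [Int.toNat_eq_max]
    push_cast
    exact max_le (by linarith) (by linarith)
  exact_mod_cast h3

set_option maxHeartbeats 2000000 in
theorem stmt19 (ε : ℝ) (hε : 0 < ε) :
    ∃ C : ℝ, 0 < C ∧
      ∀ (lam : ℝ), 1 < lam →
        ∀ (u₁ u₂ x₀₁ x₀₂ : Fin 3 → ℝ), u₁ ≠ 0 → u₂ ≠ 0 →
          (1 / 2) * Real.sqrt (∑ i, (u₁ i) ^ 2) * Real.sqrt (∑ i, (u₂ i) ^ 2) ≤
            Real.sqrt ((∑ i, (u₁ i) ^ 2) * (∑ i, (u₂ i) ^ 2) -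
              (∑ i, u₁ i * u₂ i) ^ 2) →
          (Set.ncard {n : Fin 3 → ℤ |
              (∑ i, ((n i : ℝ)) ^ 2) = lam ^ 2 ∧
              |∑ i, u₁ i * ((n i : ℝ) - x₀₁ i)| ≤ Real.sqrt (∑ i, (u₁ i) ^ 2) ∧
              |∑ i, u₂ i * ((n i : ℝ) - x₀₂ i)| ≤ Real.sqrt (∑ i, (u₂ i) ^ 2)} : ℝ)
            ≤ C * lam ^ ((1 : ℝ) / 6 + ε) := by
  classical
  obtain ⟨C0, hC0, hdiv⟩ := div_bound (ε / 6) (by positivity)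
  refine ⟨346 * (10 * (C0 * (96 : ℝ) ^ (ε / 6)) ^ 2), by positivity, ?_⟩
  intro lam hlam u v x₀₁ x₀₂ hu hv htr
  have hl0 : 0 < lam := by linarith
  set A : Set (Fin 3 → ℤ) := {n : Fin 3 → ℤ |
              (∑ i, ((n i : ℝ)) ^ 2) = lam ^ 2 ∧
              |∑ i, u i * ((n i : ℝ) - x₀₁ i)| ≤ Real.sqrt (∑ i, (u i) ^ 2) ∧
              |∑ i, v i * ((n i : ℝ) - x₀₂ i)| ≤ Real.sqrt (∑ i, (v i) ^ 2)} with hA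
  by_cases hfin : A.Finite
  swap
  · rw [Set.Infinite.ncard hfin]
    simp only [Nat.cast_zero]
    positivity
  rw [Set.ncard_eq_toFinset_card A hfin]
  set S := hfin.toFinset with hSdef
  rcases S.eq_empty_or_nonempty with hSe | ⟨n0, hn0⟩
  · rw [hSe]
    simp only [Finset.card_empty, Nat.cast_zero]
    positivity
  have hmem : ∀ n ∈ S, n ∈ A := fun n hn => hfin.mem_toFinset.mp hn
  have pos : ∀ u : Fin 3 → ℝ, u ≠ 0 → 0 < ∑ i, (u i) ^ 2 := by
    intro u hu
    obtain ⟨i, hi⟩ := Function.ne_iff.mp hu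
    exact Finset.sum_pos' (fun _ _ => sq_nonneg _)
      ⟨i, Finset.mem_univ _, by have : u i ≠ 0 := hi
                                positivity⟩
  have pu := pos u hu
  have pv := pos v hv
  set U := Real.sqrt (∑ i, (u i) ^ 2) with hU
  set V := Real.sqrt (∑ i, (v i) ^ 2) with hV
  have hU0 : 0 < U := Real.sqrt_pos.mpr pu
  have hV0 : 0 < V := Real.sqrt_pos.mpr pv
  have eU : (∑ i, (u i) ^ 2) = U ^ 2 := (Real.sq_sqrt pu.le).symm
  have eV : (∑ i, (v i) ^ 2) = V ^ 2 := (Real.sq_sqrt pv.le).symm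
  rw [eU, eV] at htr
  have htr2 : U ^ 2 * V ^ 2 / 4 ≤ U ^ 2 * V ^ 2 - (∑ i, u i * v i) ^ 2 := by
    have h1 := (Real.le_sqrt' (by positivity)).mp htr
    calc _ = (1 / 2 * U * V) ^ 2 := by ring
      _ ≤ _ := h1
  simp only [Fin.sum_univ_three] at eU eV htr2
  obtain ⟨w1, w2, w3, hw, htube⟩ := tube _ _ _ _ _ _ U V hU0 hV0 eU eV htr2
  -- choice of Q
  set r := lam ^ ((1 : ℝ) / 6) with hr
  have hr1 : 1 ≤ r := Real.one_le_rpow hlam.le (by norm_num)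
  have hr6 : r ^ 6 = lam := by
    rw [hr, ← Real.rpow_natCast, ← Real.rpow_mul hl0.le]; norm_num
  have hr3 : √lam = r ^ 3 := by
    rw [← hr6, show r ^ 6 = (r ^ 3) ^ 2 by ring, Real.sqrt_sq (by positivity)]
  set Q := ⌈r⌉₊ with hQ
  have hQr : r ≤ Q := Nat.le_ceil r
  have hQr2 : (Q : ℝ) ≤ 2 * r := by
    have := Nat.ceil_lt_add_one (show 0 ≤ r by linarith); linarith
  have hQ0 : 0 < Q := Nat.ceil_pos.mpr (by linarith)
  have w1b : |w1| ≤ 1 := by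
    apply abs_le_of_sq_le_sq _ (by norm_num); nlinarith [sq_nonneg w2, sq_nonneg w3]
  have w2b : |w2| ≤ 1 := by
    apply abs_le_of_sq_le_sq _ (by norm_num); nlinarith [sq_nonneg w1, sq_nonneg w3]
  have w3b : |w3| ≤ 1 := by
    apply abs_le_of_sq_le_sq _ (by norm_num); nlinarith [sq_nonneg w1, sq_nonneg w2]
  obtain ⟨a1, a2, a3, hne, b1, b2, b3, hη⟩ := dirichlet3 w1 w2 w3 w1b w2b w3b Q hQ0
  have sqb : ∀ a : ℤ, |a| ≤ Q → (a : ℝ) ^ 2 ≤ (Q : ℝ) ^ 2 := by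
    intro a ha
    have : |(a : ℝ)| ≤ Q := by exact_mod_cast ha
    exact sq_le_sq' (abs_le.mp this).1 (abs_le.mp this).2
  set η := 6 / (Q : ℝ) ^ 2 with hηdef
  set R := 9 * √lam * η + 16 * Q with hR
  have hR0 : 0 ≤ R := by positivity
  have hRle : R ≤ 86 * r := by
    have h1 : η ≤ 6 / r ^ 2 := by
      rw [hηdef]; gcongr
    have h2 : 9 * √lam * η ≤ 9 * r ^ 3 * (6 / r ^ 2) := by
      rw [hr3]; gcongr
    have h3 : 9 * r ^ 3 * (6 / r ^ 2) = 54 * r := by field_simp; norm_num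
    rw [hR]; linarith
  set N : ℤ := n0 0 ^ 2 + n0 1 ^ 2 + n0 2 ^ 2 with hN
  have sph : ∀ n ∈ S, (n 0 : ℝ) ^ 2 + (n 1 : ℝ) ^ 2 + (n 2 : ℝ) ^ 2 = lam ^ 2 := by
    intro n hn
    have := (hmem n hn).1
    rwa [Fin.sum_univ_three] at this
  have hNR : (N : ℝ) = lam ^ 2 := by rw [hN]; push_cast; exact sph n0 hn0
  set g : (Fin 3 → ℤ) → ℤ := fun n => a1 * n 0 + a2 * n 1 + a3 * n 2 with hg
  set c : ℝ := (g n0 : ℝ) with hc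
  set c' : ℝ := c - 2 * (n0 0 * w1 + n0 1 * w2 + n0 2 * w3) * (a1 * w1 + a2 * w2 + a3 * w3)
    with hc'
  set I := Finset.Icc ⌈c - R⌉ ⌊c + R⌋ ∪ Finset.Icc ⌈c' - R⌉ ⌊c' + R⌋ with hI
  have hIcard : (I.card : ℝ) ≤ 346 * r := by
    have h1 := int_count c R hR0
    have h2 := int_count c' R hR0
    have h3 : (I.card : ℝ) ≤ (Finset.Icc ⌈c - R⌉ ⌊c + R⌋).card +
      (Finset.Icc ⌈c' - R⌉ ⌊c' + R⌋).card := by exact_mod_cast Finset.card_union_le _ _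
    linarith
  have hmaps : ∀ n ∈ S, g n ∈ I := by
    intro n hn
    obtain ⟨-, m1, m2⟩ := hmem n hn
    obtain ⟨-, k1, k2⟩ := hmem n0 hn0
    simp only [Fin.sum_univ_three] at m1 m2 k1 k2
    have t1 := htube (n 0 - n0 0) (n 1 - n0 1) (n 2 - n0 2) (by
        simp only [Fin.sum_univ_three] at hU
        rw [← hU] at m1 k1
        rw [abs_le] at m1 k1 ⊢
        constructor <;> linarith [m1.1, m1.2, k1.1, k1.2]) (by
        simp only [Fin.sum_univ_three] at hV
        rw [← hV] at m2 k2
        rw [abs_le] at m2 k2 ⊢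
        constructor <;> linarith [m2.1, m2.2, k2.1, k2.2])
    have hv := values lam w1 w2 w3 a1 a2 a3 (n0 0) (n0 1) (n0 2) (n 0 - n0 0) (n 1 - n0 1)
      (n 2 - n0 2) Q η hlam (by positivity) hw (sqb _ b1) (sqb _ b2) (sqb _ b3) hη
      (sph n0 hn0) (by simpa using sph n hn) t1
    rw [← hR] at hv
    have e : (a1 : ℝ) * (n 0 - n0 0) + a2 * (n 1 - n0 1) + a3 * (n 2 - n0 2) = g n - c := by
      rw [hc, hg]; push_cast; ring
    rw [e] at hv
    rw [hI, Finset.mem_union, Finset.mem_Icc, Finset.mem_Icc, Int.ceil_le, Int.le_floor,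
      Int.ceil_le, Int.le_floor]
    rcases hv with h | h
    · left; rw [abs_le] at h; constructor <;> linarith [h.1, h.2]
    · right; rw [abs_le] at h; constructor <;> linarith [h.1, h.2]
  set B : ℝ := 96 * lam ^ 3 with hB
  set T : ℝ := C0 * B ^ (ε / 6) with hT
  have hl3 : 1 ≤ lam ^ 3 := one_le_pow₀ hlam.le
  have hB1 : 1 ≤ B := by rw [hB]; linarith
  have hT1 : 1 ≤ T := by
    have := Real.one_le_rpow hB1 (show 0 ≤ ε / 6 by positivity)
    rw [hT]; exact one_le_mul_of_one_le_of_one_le hC0 this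
  have hdB : ∀ n : ℕ, n ≠ 0 → (n : ℝ) ≤ B → (n.divisors.card : ℝ) ≤ T := by
    intro n hn hnB
    refine (hdiv n hn).trans ?_
    rw [hT]
    have := Real.rpow_le_rpow (Nat.cast_nonneg n) hnB (show 0 ≤ ε / 6 by positivity)
    exact mul_le_mul_of_nonneg_left this (by linarith)
  have hQB : ((6 * (Q : ℤ) ^ 4 * N : ℤ) : ℝ) ≤ B := by
    push_cast
    rw [hNR, hB]
    have h1 : (Q : ℝ) ^ 4 ≤ (2 * r) ^ 4 := by gcongr
    have h2 : r ^ 4 ≤ r ^ 6 := pow_le_pow_right₀ hr1 (by norm_num)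
    rw [hr6] at h2
    have h3 : (Q : ℝ) ^ 4 ≤ 16 * lam := by
      calc _ ≤ _ := h1
        _ = 16 * r ^ 4 := by ring
        _ ≤ _ := by linarith
    calc 6 * (Q : ℝ) ^ 4 * lam ^ 2 ≤ 6 * (16 * lam) * lam ^ 2 := by gcongr
      _ = _ := by ring
  have hNnn : 0 ≤ N := by positivity
  have hfib : ∀ m ∈ I, ((S.filter (fun n => g n = m)).card : ℝ) ≤ 10 * T ^ 2 := by
    intro m _
    refine plane_bound a1 a2 a3 m N Q hne b1 b2 b3 B T hT1 hdB hNnn hQB _ ?_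
    intro n hn
    rw [Finset.mem_filter] at hn
    refine ⟨?_, hn.2⟩
    have := (sph n hn.1).trans hNR.symm
    exact_mod_cast this
  have hcard : (S.card : ℝ) ≤ I.card * (10 * T ^ 2) := by
    rw [Finset.card_eq_sum_card_fiberwise hmaps]
    push_cast
    refine (Finset.sum_le_sum hfib).trans ?_
    rw [Finset.sum_const, nsmul_eq_mul]
  refine hcard.trans ?_
  have hTe : T ^ 2 = (C0 * (96 : ℝ) ^ (ε / 6)) ^ 2 * lam ^ ε := by
    rw [hT, hB, Real.mul_rpow (by norm_num) (by positivity)]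
    have : lam ^ ε = ((lam ^ 3) ^ (ε / 6)) ^ 2 := by
      rw [← Real.rpow_natCast, ← Real.rpow_natCast, ← Real.rpow_mul hl0.le,
        ← Real.rpow_mul hl0.le]
      congr 1; push_cast; ring
    rw [this]; ring
  rw [Real.rpow_add hl0, ← hr]
  calc (I.card : ℝ) * (10 * T ^ 2) ≤ (346 * r) * (10 * T ^ 2) := by gcongr
    _ = _ := by rw [hTe]; ring
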